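/- Let G be a finite simple graph on n vertices with degree sequence d_1, ..., d_n and let η be the number of triangles of G. Then the trace of the cube of the signless Laplacian matrix Q = D + A of G equals Σ_{i=1}^n d_i³ + 3·Σ_{i=1}^n d_i² + 6·η. (This is the order-3 trace formula of the paper's Theorem 3.1 for the signless Laplacian in the case r = 2.) -/

import Mathlib

namespace SimpleGraph

variable {V : Type*} [Fintype V] [DecidableEq V] (G : SimpleGraph V) [DecidableRel G.Adj]

/-- Every triangle is the vertex set of exactly six ordered triples of pairwise adjacent vertices. -/
theorem card_filter_adj_triple :
    (Finset.univ.filter fun p : V × V × V =>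
      G.Adj p.1 p.2.1 ∧ G.Adj p.1 p.2.2 ∧ G.Adj p.2.1 p.2.2).card =
      6 * (G.cliqueFinset 3).card := by
  rw [Finset.card_eq_sum_card_fiberwise (f := fun p : V × V × V => ({p.1, p.2.1, p.2.2} : Finset V))
    (t := G.cliqueFinset 3), Finset.sum_const_nat (m := 6), mul_comm]
  · intro s hs
    rw [mem_cliqueFinset_iff, is3Clique_iff] at hs
    obtain ⟨x, y, z, hxy, hxz, hyz, rfl⟩ := hs
    have nxy := hxy.ne
    have nxz := hxz.ne
    have nyz := hyz.ne
    have fiber_eq : ((Finset.univ.filter fun p : V × V × V =>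
        G.Adj p.1 p.2.1 ∧ G.Adj p.1 p.2.2 ∧ G.Adj p.2.1 p.2.2).filter
          fun p => ({p.1, p.2.1, p.2.2} : Finset V) = {x, y, z}) =
        {(x, y, z), (x, z, y), (y, x, z), (y, z, x), (z, x, y), (z, y, x)} := by
      ext ⟨a, b, c⟩
      simp only [Finset.mem_filter, Finset.mem_univ, true_and, Finset.mem_insert,
        Finset.mem_singleton, Prod.mk.injEq]
      constructor
      · rintro ⟨⟨hab, hac, hbc⟩, h⟩
        have ha : a ∈ ({x, y, z} : Finset V) := h ▸ by simp
        have hb : b ∈ ({x, y, z} : Finset V) := h ▸ by simp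
        have hc : c ∈ ({x, y, z} : Finset V) := h ▸ by simp
        simp only [Finset.mem_insert, Finset.mem_singleton] at ha hb hc
        have := hab.ne
        have := hac.ne
        have := hbc.ne
        grind
      · rintro (⟨rfl, rfl, rfl⟩ | ⟨rfl, rfl, rfl⟩ | ⟨rfl, rfl, rfl⟩ | ⟨rfl, rfl, rfl⟩ |
          ⟨rfl, rfl, rfl⟩ | ⟨rfl, rfl, rfl⟩) <;>
        exact ⟨by simp [*, hxy.symm, hxz.symm, hyz.symm], by grind⟩
    rw [fiber_eq]
    simp [Finset.card_insert_of_notMem, nxy, nxz, nyz, nxy.symm, nxz.symm, nyz.symm]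
  · rintro ⟨a, b, c⟩ h
    simpa [is3Clique_triple_iff] using h

variable (R : Type*)

theorem trace_adjMatrix_pow_three [Semiring R] :
    Matrix.trace (G.adjMatrix R ^ 3) = 6 * ((G.cliqueFinset 3).card : R) := by
  have h := congrArg (Nat.cast : ℕ → R) G.card_filter_adj_triple
  rw [Finset.card_filter] at h
  push_cast at h
  rw [← h, Fintype.sum_prod_type]
  simp only [Fintype.sum_prod_type, pow_succ, pow_zero, one_mul, Matrix.trace, Matrix.diag_apply,
    Matrix.mul_apply (M := _ * _), Matrix.mul_apply (M := G.adjMatrix R), Finset.sum_mul]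
  refine Finset.sum_congr rfl fun i _ => ?_
  rw [Finset.sum_comm]
  refine Finset.sum_congr rfl fun j _ => Finset.sum_congr rfl fun k _ => ?_
  simp only [adjMatrix_apply, G.adj_comm k i]
  split_ifs <;> simp_all

theorem trace_degMatrix_add_adjMatrix_pow_three [CommRing R] :
    Matrix.trace ((G.degMatrix R + G.adjMatrix R) ^ 3) =
      ∑ i, (G.degree i : R) ^ 3 + 3 * ∑ i, (G.degree i : R) ^ 2
        + 6 * ((G.cliqueFinset 3).card : R) := by
  set D := G.degMatrix R with hD
  set A := G.adjMatrix R with hA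
  have expand : Matrix.trace ((D + A) ^ 3) = Matrix.trace (D ^ 3) + 3 * Matrix.trace (D ^ 2 * A)
      + 3 * Matrix.trace (D * (A * A)) + Matrix.trace (A ^ 3) := by
    have hDAD : Matrix.trace (D * A * D) = Matrix.trace (D * D * A) :=
      Matrix.trace_mul_cycle D A D
    have hADD : Matrix.trace (A * D * D) = Matrix.trace (D * D * A) := by
      rw [Matrix.trace_mul_cycle, Matrix.trace_mul_cycle]
    have hADA : Matrix.trace (A * D * A) = Matrix.trace (D * A * A) := by
      rw [Matrix.trace_mul_cycle, Matrix.trace_mul_cycle]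
    have hAAD : Matrix.trace (A * A * D) = Matrix.trace (D * A * A) :=
      Matrix.trace_mul_cycle A A D
    simp only [pow_succ, pow_zero, one_mul, add_mul, mul_add, Matrix.trace_add, ← mul_assoc,
      hDAD, hADD, hADA, hAAD]
    ring
  have hDDD : Matrix.trace (D ^ 3) = ∑ i, (G.degree i : R) ^ 3 := by
    simp [hD, degMatrix, Matrix.diagonal_pow, Matrix.trace]
  have hDDA : Matrix.trace (D ^ 2 * A) = 0 := by
    simp only [hD, hA, degMatrix, Matrix.diagonal_pow, Matrix.trace, Matrix.diag_apply,
      Matrix.diagonal_mul]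
    simp
  have hDAA : Matrix.trace (D * (A * A)) = ∑ i, (G.degree i : R) ^ 2 := by
    simp only [hD, hA, degMatrix, Matrix.trace, Matrix.diag_apply, Matrix.diagonal_mul,
      adjMatrix_mul_self_apply_self, sq]
  rw [expand, hDDD, hDDA, hDAA, hA, trace_adjMatrix_pow_three]
  ring

end SimpleGraph


/-- For a finite simple graph `G` on `n` vertices with `η` triangles,
the trace of the cube of the signless Laplacian matrix `Q = D + A` equals
`∑ dᵢ³ + 3·∑ dᵢ² + 6·η`. -/
theorem stmt_8 (n : ℕ) (G : SimpleGraph (Fin n)) [DecidableRel G.Adj] :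
    Matrix.trace ((G.degMatrix ℝ + G.adjMatrix ℝ) ^ 3) =
      ∑ i, (G.degree i : ℝ) ^ 3 + 3 * ∑ i, (G.degree i : ℝ) ^ 2
        + 6 * ((G.cliqueFinset 3).card : ℝ) := by
  exact G.trace_degMatrix_add_adjMatrix_pow_three ℝ
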